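/- Fractal block structure: for all integers 1 ≤ M ≤ N and every j with 0 ≤ j < 4^{N−M}, there exist integers a, b, both divisible by 2^M, such that the image h_N({j·4^M, j·4^M+1, ..., (j+1)·4^M−1}) equals the aligned sub-square {a, a+1, ..., a+2^M−1} × {b, b+1, ..., b+2^M−1}; that is, any N-th order Hilbert curve is composed of 4^{N−M} Hilbert curves of order M, each filling a 2^M × 2^M sub-square of the grid. -/

import Mathlib

/-- The `N`-th order approximated Hilbert curve, mapping indices `{0,...,4^N-1}`
to nodes of the grid `{0,...,2^N-1} × {0,...,2^N-1} ⊆ ℤ × ℤ`. -/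
def hilbert : ℕ → ℕ → ℤ × ℤ
  | 0, _ => (0, 0)
  | 1, i =>
    if i = 0 then (0, 0)
    else if i = 1 then (0, 1)
    else if i = 2 then (1, 1)
    else (1, 0)
  | N + 2, i =>
    let q := i / 4 ^ (N + 1)
    let s : ℤ := 2 ^ (N + 1)
    let p := hilbert (N + 1) (i % 4 ^ (N + 1))
    if q = 0 then (p.2, p.1)
    else if q = 1 then (p.1, p.2 + s)
    else if q = 2 then (p.1 + s, p.2 + s)
    else (2 * s - 1 - p.2, s - 1 - p.1)

/-- Euclidean distance between two points of `ℤ × ℤ`. -/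
noncomputable def euclDist (a b : ℤ × ℤ) : ℝ :=
  Real.sqrt (((a.1 - b.1 : ℤ) : ℝ) ^ 2 + ((a.2 - b.2 : ℤ) : ℝ) ^ 2)

/-- Two points of `ℤ × ℤ` are edge connected if their Euclidean distance equals 1. -/
def EdgeConnected (a b : ℤ × ℤ) : Prop := euclDist a b = 1

/-- Two points of `ℤ × ℤ` are vertex connected if both coordinates differ by exactly 1. -/
def VertexConnected (a b : ℤ × ℤ) : Prop := |a.1 - b.1| = 1 ∧ |a.2 - b.2| = 1

/-- Membership in the grid `{0,...,2^N-1} × {0,...,2^N-1}`. -/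
def InGrid (N : ℕ) (p : ℤ × ℤ) : Prop :=
  0 ≤ p.1 ∧ p.1 ≤ 2 ^ N - 1 ∧ 0 ≤ p.2 ∧ p.2 ≤ 2 ^ N - 1

/-- The closed segment from `u` to `v` (centres of cells, viewed in `ℝ²`) is disjoint
from the open unit cell centred at `c`. -/
def SegAvoidsCell (u v c : ℤ × ℤ) : Prop :=
  ∀ t : ℝ, t ∈ Set.Icc (0 : ℝ) 1 →
    ¬ (|(1 - t) * (u.1 : ℝ) + t * (v.1 : ℝ) - (c.1 : ℝ)| < 1 / 2 ∧
       |(1 - t) * (u.2 : ℝ) + t * (v.2 : ℝ) - (c.2 : ℝ)| < 1 / 2)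

/-- An evasion tour for the blocked index set `B` on the `N`-th order Hilbert grid:
a sequence of waypoints `w 0, ..., w m` in the grid, starting at the entry node,
ending at the exit node, avoiding all blocked nodes, covering every unblocked grid
point, and whose straight-line segments avoid the interiors of all blocked cells. -/
def IsEvasionTour (N : ℕ) (B : Finset ℕ) (m : ℕ) (w : ℕ → ℤ × ℤ) : Prop :=
  w 0 = hilbert N 0 ∧
  w m = hilbert N (4 ^ N - 1) ∧
  (∀ j ≤ m, InGrid N (w j)) ∧
  (∀ j ≤ m, ∀ b ∈ B, w j ≠ hilbert N b) ∧
  (∀ p : ℤ × ℤ, InGrid N p → (∀ b ∈ B, p ≠ hilbert N b) → ∃ j ≤ m, w j = p) ∧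
  (∀ j < m, ∀ b ∈ B, SegAvoidsCell (w j) (w (j + 1)) (hilbert N b))

/-- The placement of the `q`-th quadrant in the recursive construction of the Hilbert curve,
where `s` is the side length of a quadrant. -/
def hilbertQuadrant (q : ℕ) (s : ℤ) (p : ℤ × ℤ) : ℤ × ℤ :=
  if q = 0 then (p.2, p.1)
  else if q = 1 then (p.1, p.2 + s)
  else if q = 2 then (p.1 + s, p.2 + s)
  else (2 * s - 1 - p.2, s - 1 - p.1)

theorem hilbert_succ {N i : ℕ} (hi : i < 4 ^ (N + 1)) :
    hilbert (N + 1) i = hilbertQuadrant (i / 4 ^ N) (2 ^ N) (hilbert N (i % 4 ^ N)) := by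
  cases N with
  | zero =>
    simp only [hilbert, hilbertQuadrant, zero_add, pow_zero, Nat.div_one]
    split_ifs <;> rfl
  | succ N => rfl

theorem hilbert_succ_mul_add {N q r : ℕ} (hq : q < 4) (hr : r < 4 ^ N) :
    hilbert (N + 1) (q * 4 ^ N + r) = hilbertQuadrant q (2 ^ N) (hilbert N r) := by
  have hi : q * 4 ^ N + r < 4 ^ (N + 1) := by rw [pow_succ]; nlinarith
  rw [hilbert_succ hi, mul_comm q, Nat.mul_add_div (by positivity), Nat.mul_add_mod,
    Nat.div_eq_of_lt hr, Nat.mod_eq_of_lt hr, add_zero]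

theorem image_hilbert_succ_Ico {N q c d : ℕ} (hq : q < 4) (hd : d ≤ 4 ^ N) :
    hilbert (N + 1) '' Set.Ico (q * 4 ^ N + c) (q * 4 ^ N + d) =
      hilbertQuadrant q (2 ^ N) '' (hilbert N '' Set.Ico c d) := by
  rw [← Set.image_const_add_Ico, Set.image_image, Set.image_image]
  exact Set.image_congr fun r hr => hilbert_succ_mul_add hq (hr.2.trans_le hd)

/-- A quadrant placement maps aligned squares to aligned squares. -/
theorem exists_image_hilbertQuadrant_square (q : ℕ) {w s a b : ℤ}
    (hs : w ∣ s) (ha : w ∣ a) (hb : w ∣ b) :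
    ∃ a' b' : ℤ, w ∣ a' ∧ w ∣ b' ∧
      hilbertQuadrant q s '' (Set.Icc a (a + w - 1) ×ˢ Set.Icc b (b + w - 1)) =
        Set.Icc a' (a' + w - 1) ×ˢ Set.Icc b' (b' + w - 1) := by
  unfold hilbertQuadrant
  split_ifs
  · refine ⟨b, a, hb, ha, ?_⟩
    ext ⟨x, y⟩
    simp only [Set.mem_image, Set.mem_prod, Set.mem_Icc, Prod.exists, Prod.mk.injEq]
    exact ⟨by rintro ⟨u, v, h, rfl, rfl⟩; omega, fun h => ⟨y, x, by omega⟩⟩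
  · refine ⟨a, b + s, ha, hb.add hs, ?_⟩
    ext ⟨x, y⟩
    simp only [Set.mem_image, Set.mem_prod, Set.mem_Icc, Prod.exists, Prod.mk.injEq]
    exact ⟨by rintro ⟨u, v, h, rfl, rfl⟩; omega, fun h => ⟨x, y - s, by omega⟩⟩
  · refine ⟨a + s, b + s, ha.add hs, hb.add hs, ?_⟩
    ext ⟨x, y⟩
    simp only [Set.mem_image, Set.mem_prod, Set.mem_Icc, Prod.exists, Prod.mk.injEq]
    exact ⟨by rintro ⟨u, v, h, rfl, rfl⟩; omega, fun h => ⟨x - s, y - s, by omega⟩⟩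
  · refine ⟨2 * s - b - w, s - a - w, ((hs.mul_left 2).sub hb).sub dvd_rfl,
      (hs.sub ha).sub dvd_rfl, ?_⟩
    ext ⟨x, y⟩
    simp only [Set.mem_image, Set.mem_prod, Set.mem_Icc, Prod.exists, Prod.mk.injEq]
    exact ⟨by rintro ⟨u, v, h, rfl, rfl⟩; omega,
      fun h => ⟨s - 1 - y, 2 * s - 1 - x, by omega⟩⟩

/-- The four quadrants tile the square of twice the side length. -/
theorem exists_hilbertQuadrant_eq_iff (s : ℤ) (p : ℤ × ℤ) :
    (∃ q < 4, ∃ u ∈ Set.Icc 0 (s - 1) ×ˢ Set.Icc 0 (s - 1), hilbertQuadrant q s u = p) ↔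
      p ∈ Set.Icc 0 (2 * s - 1) ×ˢ Set.Icc 0 (2 * s - 1) := by
  obtain ⟨x, y⟩ := p
  simp only [Set.mem_prod, Set.mem_Icc, Prod.exists]
  constructor
  · rintro ⟨q, hq, u, v, h, he⟩
    unfold hilbertQuadrant at he
    split_ifs at he <;> rw [Prod.mk.injEq] at he <;> omega
  · intro h
    rcases lt_or_ge x s with hx | hx <;> rcases lt_or_ge y s with hy | hy
    · exact ⟨0, by norm_num, y, x, by omega, by simp [hilbertQuadrant]⟩
    · exact ⟨1, by norm_num, x, y - s, by omega, by simp [hilbertQuadrant]⟩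
    · exact ⟨3, by norm_num, s - 1 - y, 2 * s - 1 - x, by omega, by simp [hilbertQuadrant]⟩
    · exact ⟨2, by norm_num, x - s, y - s, by omega, by simp [hilbertQuadrant]⟩

/-- The Hilbert curve of order `N` fills the `2 ^ N × 2 ^ N` grid. -/
theorem image_hilbert_Ico (N : ℕ) :
    hilbert N '' Set.Ico 0 (4 ^ N) = Set.Icc 0 (2 ^ N - 1) ×ˢ Set.Icc 0 (2 ^ N - 1) := by
  induction N with
  | zero => simp [hilbert]
  | succ N ih =>
    ext p
    rw [pow_succ' (2 : ℤ), ← exists_hilbertQuadrant_eq_iff, ← ih]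
    simp only [Set.mem_image, Set.mem_Ico, zero_le, true_and]
    constructor
    · rintro ⟨i, hi, rfl⟩
      refine ⟨i / 4 ^ N, ?_, _, ⟨i % 4 ^ N, Nat.mod_lt _ (by positivity), rfl⟩,
        (hilbert_succ hi).symm⟩
      rw [pow_succ'] at hi
      exact Nat.div_lt_of_lt_mul (by rwa [mul_comm])
    · rintro ⟨q, hq, _, ⟨r, hr, rfl⟩, rfl⟩
      exact ⟨q * 4 ^ N + r, by rw [pow_succ]; nlinarith, hilbert_succ_mul_add hq hr⟩

theorem exists_image_hilbert_add_Ico (M k j : ℕ) (hj : j < 4 ^ k) :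
    ∃ a b : ℤ, (2 ^ M : ℤ) ∣ a ∧ (2 ^ M : ℤ) ∣ b ∧
      hilbert (M + k) '' Set.Ico (j * 4 ^ M) ((j + 1) * 4 ^ M) =
        Set.Icc a (a + 2 ^ M - 1) ×ˢ Set.Icc b (b + 2 ^ M - 1) := by
  induction k generalizing j with
  | zero =>
    obtain rfl : j = 0 := by simpa using hj
    exact ⟨0, 0, dvd_zero _, dvd_zero _, by simpa using image_hilbert_Ico M⟩
  | succ k ih =>
    have hr : j % 4 ^ k < 4 ^ k := Nat.mod_lt _ (by positivity)
    have hq : j / 4 ^ k < 4 := Nat.div_lt_of_lt_mul (by rwa [← pow_succ])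
    obtain ⟨a, b, ha, hb, hab⟩ := ih _ hr
    have hd : (j % 4 ^ k + 1) * 4 ^ M ≤ 4 ^ (M + k) := by
      rw [pow_add, mul_comm]
      exact Nat.mul_le_mul_left _ hr
    have hdiv := Nat.div_add_mod j (4 ^ k)
    have hlo : j * 4 ^ M = j / 4 ^ k * 4 ^ (M + k) + j % 4 ^ k * 4 ^ M := by
      rw [pow_add]
      nth_rewrite 1 [← hdiv]
      ring
    have hhi : (j + 1) * 4 ^ M = j / 4 ^ k * 4 ^ (M + k) + (j % 4 ^ k + 1) * 4 ^ M := by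
      rw [add_mul, hlo]
      ring
    rw [hlo, hhi, ← add_assoc, image_hilbert_succ_Ico hq hd, hab]
    exact exists_image_hilbertQuadrant_square _ (pow_dvd_pow 2 (Nat.le_add_right M k)) ha hb

theorem hilbert_fractal_block (N M j : ℕ) (hM : 1 ≤ M) (hMN : M ≤ N)
    (hj : j < 4 ^ (N - M)) :
    ∃ a b : ℤ, (2 ^ M : ℤ) ∣ a ∧ (2 ^ M : ℤ) ∣ b ∧
      hilbert N '' Set.Ico (j * 4 ^ M) ((j + 1) * 4 ^ M) =
        Set.Icc a (a + 2 ^ M - 1) ×ˢ Set.Icc b (b + 2 ^ M - 1) := by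
  obtain ⟨k, rfl⟩ := Nat.exists_eq_add_of_le hMN
  rw [Nat.add_sub_cancel_left] at hj
  exact exists_image_hilbert_add_Ico M k j hj
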